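/- With the Selberg setup below, set x_δ = ∑_{d ≤ z, d | P_a(z), δ | d} ρ_d·g(d) for each squarefree δ. Then ∑_{d_1, d_2 | P_a(z), d_1 ≤ z, d_2 ≤ z} ρ_{d_1}ρ_{d_2}·g(lcm(d_1, d_2)) = ∑_{δ | P_a(z), δ ≤ z} x_δ²/h(δ) = 1/H_a(z). -/

import Mathlib

open Finset

/-- `P_a(z) = ∏_{p ≤ z, p ∤ a} p`, the product over primes up to `z` not dividing `a`. -/
noncomputable def Pa (z : ℝ) (a : ℕ) : ℕ :=
  ∏ p ∈ (Finset.range (⌊z⌋₊ + 1)).filter (fun p => p.Prime ∧ ¬p ∣ a), p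

/-- `H_a(z) = ∑_{k ≤ z, (k,a)=1} μ(k)² h(k)`. -/
noncomputable def Ha (z : ℝ) (a : ℕ) (h : ℕ → ℝ) : ℝ :=
  ∑ k ∈ (Finset.Icc 1 ⌊z⌋₊).filter (fun k => Nat.gcd k a = 1),
    (ArithmeticFunction.moebius k : ℝ) ^ 2 * h k

/-- The Selberg sieve coefficients
`ρ_d = (μ(d)h(d)/(H_a(z) g(d))) ∑_{k ≤ z/d, kd | P_a(z)} μ(k)² h(k)`. -/
noncomputable def rhoCoeff (z : ℝ) (a : ℕ) (g h : ℕ → ℝ) (d : ℕ) : ℝ :=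
  ((ArithmeticFunction.moebius d : ℝ) * h d / (Ha z a h * g d)) *
    ∑ k ∈ (Finset.Icc 1 ⌊z / (d : ℝ)⌋₊).filter (fun k => k * d ∣ Pa z a),
      (ArithmeticFunction.moebius k : ℝ) ^ 2 * h k

/-- `x_δ = ∑_{d ≤ z, d | P_a(z), δ | d} ρ_d g(d)`. -/
noncomputable def xCoeff (z : ℝ) (a : ℕ) (g h : ℕ → ℝ) (δ : ℕ) : ℝ :=
  ∑ d ∈ (Finset.Icc 1 ⌊z⌋₊).filter (fun d => d ∣ Pa z a ∧ δ ∣ d),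
    rhoCoeff z a g h d * g d

open ArithmeticFunction in
/-- A multiplicative function `ℕ → ℝ` agrees with a multiplicative arithmetic function away from
`0`. -/
lemma exists_isMultiplicative_eq (f : ℕ → ℝ) (hf1 : f 1 = 1)
    (hfmul : ∀ m n : ℕ, Nat.Coprime m n → f (m * n) = f m * f n) :
    ∃ F : ArithmeticFunction ℝ, F.IsMultiplicative ∧ ∀ n ≠ 0, F n = f n := by
  refine ⟨(⟨fun n => if n = 0 then 0 else f n, by simp⟩ : ArithmeticFunction ℝ), ?_, fun n hn => by simp [hn]⟩
  refine IsMultiplicative.iff_ne_zero.mpr ⟨by simp [hf1], fun {m n} hm hn hmn => ?_⟩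
  simp [hm, hn, hfmul m n hmn]

/-- A multiplicative function at a squarefree number is the product of its values at the prime
factors. -/
lemma eq_prod_primeFactors (f : ℕ → ℝ) (hf1 : f 1 = 1)
    (hfmul : ∀ m n : ℕ, Nat.Coprime m n → f (m * n) = f m * f n) {n : ℕ} (hn : Squarefree n) :
    f n = ∏ p ∈ n.primeFactors, f p := by
  obtain ⟨F, hF, hFf⟩ := exists_isMultiplicative_eq f hf1 hfmul
  rw [← hFf n hn.ne_zero, ← hF.prod_primeFactors hn]
  exact Finset.prod_congr rfl fun p hp => hFf p (Nat.prime_of_mem_primeFactors hp).ne_zero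

/-- If `1 / g p = 1 + 1 / h p` at primes, then `1 / g` is the divisor sum of `1 / h` at squarefree
numbers. -/
lemma inv_eq_sum_divisors_inv (g h : ℕ → ℝ)
    (hg1 : g 1 = 1) (hgmul : ∀ m n : ℕ, Nat.Coprime m n → g (m * n) = g m * g n)
    (hh1 : h 1 = 1) (hhmul : ∀ m n : ℕ, Nat.Coprime m n → h (m * n) = h m * h n)
    (hgh : ∀ p : ℕ, p.Prime → (g p)⁻¹ = 1 + (h p)⁻¹) {n : ℕ} (hn : Squarefree n) :
    (g n)⁻¹ = ∑ d ∈ n.divisors, (h d)⁻¹ := by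
  obtain ⟨F, hF, hFh⟩ := exists_isMultiplicative_eq (fun n => (h n)⁻¹) (by simp [hh1])
    (fun m n hmn => by simp [hhmul m n hmn, mul_comm])
  have key := hF.prodPrimeFactors_one_add_of_squarefree hn
  rw [eq_prod_primeFactors g hg1 hgmul hn, ← Finset.prod_inv_distrib,
    ← Finset.sum_congr rfl fun d hd => hFh d (Nat.pos_of_mem_divisors hd).ne', ← key]
  refine Finset.prod_congr rfl fun p hp => ?_
  have hp' := Nat.prime_of_mem_primeFactors hp
  rw [hFh p hp'.ne_zero, hgh p hp']

/-- The Möbius function summed over the divisors of a squarefree `m` that are multiples of `δ`. -/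
lemma sum_moebius_divisors_filter_dvd {m δ : ℕ} (hm : Squarefree m) (hδ : δ ∣ m) :
    ∑ d ∈ m.divisors with δ ∣ d, (ArithmeticFunction.moebius d : ℝ) =
      if m = δ then (ArithmeticFunction.moebius δ : ℝ) else 0 := by
  obtain ⟨e, rfl⟩ := hδ
  have hδ0 : δ ≠ 0 := left_ne_zero_of_mul hm.ne_zero
  have he0 : e ≠ 0 := right_ne_zero_of_mul hm.ne_zero
  have hcop : Nat.Coprime δ e := Nat.coprime_of_squarefree_mul hm
  have himage : (δ * e).divisors.filter (δ ∣ ·) = e.divisors.image (δ * ·) := by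
    ext d
    simp only [Finset.mem_filter, Nat.mem_divisors, Finset.mem_image]
    constructor
    · rintro ⟨⟨h1, _⟩, k, rfl⟩
      exact ⟨k, ⟨Nat.dvd_of_mul_dvd_mul_left (Nat.pos_of_ne_zero hδ0) h1, he0⟩, rfl⟩
    · rintro ⟨k, ⟨hk, _⟩, rfl⟩
      exact ⟨⟨mul_dvd_mul_left δ hk, hm.ne_zero⟩, dvd_mul_right _ _⟩
  have hsum : ∑ j ∈ e.divisors, ArithmeticFunction.moebius j = if e = 1 then 1 else 0 := by
    rw [← ArithmeticFunction.coe_mul_zeta_apply, ArithmeticFunction.moebius_mul_coe_zeta,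
      ArithmeticFunction.one_apply]
  rw [himage, Finset.sum_image fun x _ y _ hxy => Nat.eq_of_mul_eq_mul_left
    (Nat.pos_of_ne_zero hδ0) hxy]
  have hmul : ∀ j ∈ e.divisors, (ArithmeticFunction.moebius (δ * j) : ℝ) =
      ArithmeticFunction.moebius δ * (ArithmeticFunction.moebius j : ℝ) := fun j hj => by
    rw [ArithmeticFunction.isMultiplicative_moebius.map_mul_of_coprime
      (hcop.coprime_dvd_right (Nat.dvd_of_mem_divisors hj))]
    push_cast
    rfl
  rw [Finset.sum_congr rfl hmul, ← Finset.mul_sum, ← Int.cast_sum, hsum]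
  simp [hδ0]

lemma squarefree_Pa (z : ℝ) (a : ℕ) : Squarefree (Pa z a) := by
  refine Finset.squarefree_prod_of_pairwise_isCoprime (fun p hp q hq hpq => ?_) fun p hp => ?_
  · simp only [Finset.coe_filter, Set.mem_ofPred_eq] at hp hq
    exact Nat.coprime_iff_isRelPrime.mp ((Nat.coprime_primes hp.2.1 hq.2.1).mpr hpq)
  · exact (Finset.mem_filter.mp hp).2.1.prime.squarefree

lemma dvd_Pa_iff {z : ℝ} {a k : ℕ} (hk : k ∈ Finset.Icc 1 ⌊z⌋₊) :
    k ∣ Pa z a ↔ Squarefree k ∧ Nat.gcd k a = 1 := by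
  rw [Finset.mem_Icc] at hk
  constructor
  · intro hd
    refine ⟨(squarefree_Pa z a).squarefree_of_dvd hd, Nat.Coprime.coprime_dvd_left hd ?_⟩
    refine Nat.Coprime.prod_left fun p hp => ?_
    obtain ⟨-, hp, hpa⟩ := Finset.mem_filter.mp hp
    exact (Nat.Prime.coprime_iff_not_dvd hp).mpr hpa
  · rintro ⟨hsq, hcop⟩
    rw [← Nat.prod_primeFactors_of_squarefree hsq]
    refine Finset.prod_dvd_prod_of_subset _ _ _ fun p hp => ?_
    have hpp := Nat.prime_of_mem_primeFactors hp
    have hpk := Nat.dvd_of_mem_primeFactors hp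
    refine Finset.mem_filter.mpr ⟨Finset.mem_range.mpr ?_, hpp, fun hpa => ?_⟩
    · have := Nat.le_of_dvd hk.1 hpk
      omega
    · exact hpp.one_lt.ne' (Nat.dvd_one.mp (hcop ▸ Nat.dvd_gcd hpk hpa))

/-- `H_a(z)` is the sum of `h` over the divisors of `P_a(z)` up to `z`. -/
lemma Ha_eq_sum (z : ℝ) (a : ℕ) (h : ℕ → ℝ) :
    Ha z a h = ∑ m ∈ (Finset.Icc 1 ⌊z⌋₊).filter (fun d => d ∣ Pa z a), h m := by
  rw [Ha, Finset.sum_filter, Finset.sum_filter]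
  refine Finset.sum_congr rfl fun k hk => ?_
  have hmu : (ArithmeticFunction.moebius k : ℝ) ^ 2 = if Squarefree k then 1 else 0 := by
    exact_mod_cast ArithmeticFunction.moebius_sq (n := k)
  rw [hmu]
  simp only [dvd_Pa_iff hk]
  split_ifs <;> simp_all

/-- `ρ_d g(d)` as a sum of `h` over the multiples of `d` among the divisors of `P_a(z)`. -/
lemma rhoCoeff_mul {z : ℝ} {a : ℕ} {g h : ℕ → ℝ}
    (hhmul : ∀ m n : ℕ, Nat.Coprime m n → h (m * n) = h m * h n) {d : ℕ} (hd : 1 ≤ d)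
    (hgd : g d ≠ 0) :
    rhoCoeff z a g h d * g d = (ArithmeticFunction.moebius d : ℝ) / Ha z a h *
      ∑ m ∈ (Finset.Icc 1 ⌊z⌋₊).filter (fun m => m ∣ Pa z a) with d ∣ m, h m := by
  have hsum : ∑ m ∈ (Finset.Icc 1 ⌊z⌋₊).filter (fun m => m ∣ Pa z a) with d ∣ m, h m =
      h d * ∑ k ∈ (Finset.Icc 1 ⌊z / (d : ℝ)⌋₊).filter (fun k => k * d ∣ Pa z a),
        (ArithmeticFunction.moebius k : ℝ) ^ 2 * h k := by
    rw [Finset.mul_sum]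
    symm
    refine Finset.sum_bij (fun k _ => k * d) (fun k hk => ?_)
      (fun k _ l _ hkl => Nat.eq_of_mul_eq_mul_right hd hkl) (fun m hm => ?_) (fun k hk => ?_)
    · simp only [Finset.mem_filter, Finset.mem_Icc, Nat.floor_div_natCast,
        Nat.le_div_iff_mul_le hd] at hk ⊢
      exact ⟨⟨⟨Nat.mul_pos hk.1.1 hd, hk.1.2⟩, hk.2⟩, dvd_mul_left _ _⟩
    · simp only [Finset.mem_filter, Finset.mem_Icc] at hm
      obtain ⟨⟨⟨hm1, hmz⟩, hmP⟩, k, rfl⟩ := hm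
      rw [mul_comm] at hmz hmP
      refine ⟨k, ?_, mul_comm _ _⟩
      simp only [Finset.mem_filter, Finset.mem_Icc, Nat.floor_div_natCast,
        Nat.le_div_iff_mul_le hd]
      exact ⟨⟨Nat.pos_of_mul_pos_left hm1, hmz⟩, hmP⟩
    · have hsq := (squarefree_Pa z a).squarefree_of_dvd (Finset.mem_filter.mp hk).2
      have hmu : (ArithmeticFunction.moebius k : ℝ) ^ 2 = 1 := by
        exact_mod_cast ArithmeticFunction.moebius_sq_eq_one_of_squarefree
          (hsq.squarefree_of_dvd (dvd_mul_right k d))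
      rw [hmu, hhmul k d (Nat.coprime_of_squarefree_mul hsq)]
      ring
  rw [hsum, rhoCoeff]
  by_cases hH : Ha z a h = 0
  · simp [hH]
  · field_simp

/-- The closed form `x_δ = μ(δ) h(δ) / H_a(z)`. -/
lemma xCoeff_eq {z : ℝ} {a : ℕ} {g h : ℕ → ℝ}
    (hhmul : ∀ m n : ℕ, Nat.Coprime m n → h (m * n) = h m * h n)
    (hg : ∀ n, Squarefree n → g n ≠ 0) {δ : ℕ}
    (hδ : δ ∈ (Finset.Icc 1 ⌊z⌋₊).filter (fun δ => δ ∣ Pa z a)) :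
    xCoeff z a g h δ = (ArithmeticFunction.moebius δ : ℝ) * h δ / Ha z a h := by
  have hsq : ∀ m ∈ (Finset.Icc 1 ⌊z⌋₊).filter (fun m => m ∣ Pa z a), Squarefree m := fun m hm =>
    (squarefree_Pa z a).squarefree_of_dvd (Finset.mem_filter.mp hm).2
  set D := (Finset.Icc 1 ⌊z⌋₊).filter (fun m => m ∣ Pa z a) with hD
  have hinner : ∀ m ∈ D, ∑ d ∈ D with δ ∣ d, (if d ∣ m then
      (ArithmeticFunction.moebius d : ℝ) else 0) =
      if m = δ then (ArithmeticFunction.moebius δ : ℝ) else 0 := by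
    intro m hm
    have hm' := hm
    simp only [hD, Finset.mem_filter, Finset.mem_Icc] at hm'
    have hset : (D.filter (δ ∣ ·)).filter (· ∣ m) = m.divisors.filter (δ ∣ ·) := by
      ext d
      simp only [hD, Finset.mem_filter, Finset.mem_Icc, Nat.mem_divisors]
      constructor
      · rintro ⟨⟨_, h1⟩, h2⟩
        exact ⟨⟨h2, (hsq m hm).ne_zero⟩, h1⟩
      · rintro ⟨⟨h2, _⟩, h1⟩
        exact ⟨⟨⟨⟨Nat.pos_of_dvd_of_pos h2 hm'.1.1, (Nat.le_of_dvd hm'.1.1 h2).trans hm'.1.2⟩,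
          h2.trans hm'.2⟩, h1⟩, h2⟩
    rw [← Finset.sum_filter, hset]
    by_cases hdm : δ ∣ m
    · exact sum_moebius_divisors_filter_dvd (hsq m hm) hdm
    · rw [Finset.filter_eq_empty_iff.mpr fun d hd hδd =>
        hdm (hδd.trans (Nat.dvd_of_mem_divisors hd)), Finset.sum_empty, if_neg]
      rintro rfl
      exact hdm dvd_rfl
  calc xCoeff z a g h δ
      = ∑ d ∈ D with δ ∣ d, rhoCoeff z a g h d * g d := by
        rw [xCoeff, hD, Finset.filter_filter]
    _ = ∑ d ∈ D with δ ∣ d, ∑ m ∈ D,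
          (if d ∣ m then (ArithmeticFunction.moebius d : ℝ) else 0) * (h m / Ha z a h) := by
        refine Finset.sum_congr rfl fun d hd => ?_
        have hdD := (Finset.mem_filter.mp hd).1
        rw [rhoCoeff_mul hhmul (Nat.pos_of_ne_zero (hsq d hdD).ne_zero) (hg d (hsq d hdD)),
          Finset.sum_filter, Finset.mul_sum]
        refine Finset.sum_congr rfl fun m _ => ?_
        split_ifs <;> ring
    _ = ∑ m ∈ D, (if m = δ then (ArithmeticFunction.moebius δ : ℝ) else 0) *
          (h m / Ha z a h) := by
        rw [Finset.sum_comm]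
        exact Finset.sum_congr rfl fun m hm => by rw [← Finset.sum_mul, hinner m hm]
    _ = (ArithmeticFunction.moebius δ : ℝ) * h δ / Ha z a h := by
        simp only [ite_mul, zero_mul, Finset.sum_ite_eq', if_pos hδ, mul_div_assoc]

/-- The quadratic form with matrix `g(lcm(d₁, d₂))` is diagonal in the variables
`∑_{δ ∣ d} w_d g(d)`. -/
lemma sum_sum_mul_lcm_eq_sum_sq_div {z : ℝ} {a : ℕ} {g h : ℕ → ℝ} (w : ℕ → ℝ)
    (hg1 : g 1 = 1) (hgmul : ∀ m n : ℕ, Nat.Coprime m n → g (m * n) = g m * g n)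
    (hg : ∀ n, Squarefree n → g n ≠ 0)
    (hinv : ∀ n, Squarefree n → (g n)⁻¹ = ∑ d ∈ n.divisors, (h d)⁻¹) :
    (∑ d₁ ∈ (Finset.Icc 1 ⌊z⌋₊).filter (fun d => d ∣ Pa z a),
        ∑ d₂ ∈ (Finset.Icc 1 ⌊z⌋₊).filter (fun d => d ∣ Pa z a),
          w d₁ * w d₂ * g (Nat.lcm d₁ d₂)) =
      ∑ δ ∈ (Finset.Icc 1 ⌊z⌋₊).filter (fun δ => δ ∣ Pa z a),
        (∑ d ∈ (Finset.Icc 1 ⌊z⌋₊).filter (fun d => d ∣ Pa z a ∧ δ ∣ d), w d * g d) ^ 2 / h δ := by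
  obtain ⟨G, hG, hGg⟩ := exists_isMultiplicative_eq g hg1 hgmul
  have hsq : ∀ m ∈ (Finset.Icc 1 ⌊z⌋₊).filter (fun m => m ∣ Pa z a), Squarefree m := fun m hm =>
    (squarefree_Pa z a).squarefree_of_dvd (Finset.mem_filter.mp hm).2
  simp only [← Finset.filter_filter]
  set D := (Finset.Icc 1 ⌊z⌋₊).filter (fun m => m ∣ Pa z a) with hD
  have hterm : ∀ d₁ ∈ D, ∀ d₂ ∈ D, w d₁ * w d₂ * g (Nat.lcm d₁ d₂) =
      ∑ δ ∈ D, (if δ ∣ d₁ then w d₁ * g d₁ else 0) * (if δ ∣ d₂ then w d₂ * g d₂ else 0) *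
        (h δ)⁻¹ := by
    intro d₁ hd₁ d₂ hd₂
    have h1 := (hsq d₁ hd₁).ne_zero
    have h2 := (hsq d₂ hd₂).ne_zero
    have hgcd := (hsq d₁ hd₁).squarefree_of_dvd (Nat.gcd_dvd_left d₁ d₂)
    have hlcm : g (Nat.lcm d₁ d₂) = g d₁ * g d₂ * (g (Nat.gcd d₁ d₂))⁻¹ := by
      rw [eq_mul_inv_iff_mul_eq₀ (hg _ hgcd), ← hGg _ h1, ← hGg _ h2, ← hGg _ hgcd.ne_zero,
        ← hGg _ (Nat.lcm_ne_zero h1 h2), hG.lcm_apply_mul_gcd_apply]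
    have hset : (Nat.gcd d₁ d₂).divisors = D.filter (fun δ => δ ∣ d₁ ∧ δ ∣ d₂) := by
      ext δ
      simp only [hD, Finset.mem_filter, Finset.mem_Icc, Nat.mem_divisors, Nat.dvd_gcd_iff] at hd₁ ⊢
      constructor
      · rintro ⟨hδ, _⟩
        exact ⟨⟨⟨Nat.pos_of_dvd_of_pos hδ.1 hd₁.1.1, (Nat.le_of_dvd hd₁.1.1 hδ.1).trans hd₁.1.2⟩,
          hδ.1.trans hd₁.2⟩, hδ⟩
      · rintro ⟨_, hδ⟩
        exact ⟨hδ, hgcd.ne_zero⟩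
    rw [hlcm, hinv _ hgcd, hset, Finset.sum_filter, Finset.mul_sum, Finset.mul_sum]
    refine Finset.sum_congr rfl fun δ _ => ?_
    by_cases hδ₁ : δ ∣ d₁ <;> by_cases hδ₂ : δ ∣ d₂ <;> simp only [hδ₁, hδ₂, and_self, and_true,
      and_false, if_true, if_false] <;> ring
  rw [Finset.sum_congr rfl fun d₁ hd₁ => Finset.sum_congr rfl (hterm d₁ hd₁),
    Finset.sum_congr rfl fun d₁ _ => Finset.sum_comm, Finset.sum_comm]
  refine Finset.sum_congr rfl fun δ _ => ?_
  rw [sq, Finset.sum_filter (δ ∣ ·), Finset.sum_mul_sum, div_eq_mul_inv, Finset.sum_mul]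
  exact Finset.sum_congr rfl fun d₁ _ => (Finset.sum_mul _ _ _).symm

/-- The Selberg diagonalization identity:
`∑_{d₁,d₂ | P_a(z), d₁,d₂ ≤ z} ρ_{d₁} ρ_{d₂} g([d₁,d₂]) = ∑_{δ | P_a(z), δ ≤ z} x_δ²/h(δ)
= 1/H_a(z)`. -/
theorem selberg_diagonalization (a : ℕ) (ha : 1 ≤ a) (z : ℝ) (hz : 2 ≤ z) (g h : ℕ → ℝ)
    (hg1 : g 1 = 1) (hgmul : ∀ m n : ℕ, Nat.Coprime m n → g (m * n) = g m * g n)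
    (hgp : ∀ p : ℕ, p.Prime → 0 < g p ∧ g p < 1)
    (hh1 : h 1 = 1) (hhmul : ∀ m n : ℕ, Nat.Coprime m n → h (m * n) = h m * h n)
    (hhp : ∀ p : ℕ, p.Prime → h p = g p / (1 - g p)) :
    (∑ d₁ ∈ (Finset.Icc 1 ⌊z⌋₊).filter (fun d => d ∣ Pa z a),
        ∑ d₂ ∈ (Finset.Icc 1 ⌊z⌋₊).filter (fun d => d ∣ Pa z a),
          rhoCoeff z a g h d₁ * rhoCoeff z a g h d₂ * g (Nat.lcm d₁ d₂)) =
      (∑ δ ∈ (Finset.Icc 1 ⌊z⌋₊).filter (fun δ => δ ∣ Pa z a),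
        xCoeff z a g h δ ^ 2 / h δ) ∧
    (∑ δ ∈ (Finset.Icc 1 ⌊z⌋₊).filter (fun δ => δ ∣ Pa z a),
        xCoeff z a g h δ ^ 2 / h δ) = 1 / Ha z a h := by
  have hpos_g : ∀ n, Squarefree n → 0 < g n := fun n hn => by
    rw [eq_prod_primeFactors g hg1 hgmul hn]
    exact Finset.prod_pos fun p hp => (hgp p (Nat.prime_of_mem_primeFactors hp)).1
  have hpos_hp : ∀ p : ℕ, p.Prime → 0 < h p := fun p hp => by
    rw [hhp p hp]
    exact div_pos (hgp p hp).1 (sub_pos.mpr (hgp p hp).2)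
  have hpos_h : ∀ n, Squarefree n → 0 < h n := fun n hn => by
    rw [eq_prod_primeFactors h hh1 hhmul hn]
    exact Finset.prod_pos fun p hp => hpos_hp p (Nat.prime_of_mem_primeFactors hp)
  have hg0 : ∀ n, Squarefree n → g n ≠ 0 := fun n hn => (hpos_g n hn).ne'
  have hgh : ∀ p : ℕ, p.Prime → (g p)⁻¹ = 1 + (h p)⁻¹ := fun p hp => by
    have h1 := (hgp p hp).1.ne'
    rw [hhp p hp, inv_div]
    field_simp
    ring
  refine ⟨sum_sum_mul_lcm_eq_sum_sq_div (rhoCoeff z a g h) hg1 hgmul hg0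
    fun n hn => inv_eq_sum_divisors_inv g h hg1 hgmul hh1 hhmul hgh hn, ?_⟩
  have hterm : ∀ δ ∈ (Finset.Icc 1 ⌊z⌋₊).filter (fun δ => δ ∣ Pa z a),
      xCoeff z a g h δ ^ 2 / h δ = h δ / Ha z a h ^ 2 := fun δ hδ => by
    have hsq := (squarefree_Pa z a).squarefree_of_dvd (Finset.mem_filter.mp hδ).2
    have hmu : (ArithmeticFunction.moebius δ : ℝ) ^ 2 = 1 := by
      exact_mod_cast ArithmeticFunction.moebius_sq_eq_one_of_squarefree hsq
    have hh0 := (hpos_h δ hsq).ne'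
    rw [xCoeff_eq hhmul hg0 hδ, div_pow, mul_pow, hmu]
    field_simp
  rw [Finset.sum_congr rfl hterm, ← Finset.sum_div, ← Ha_eq_sum, sq, div_self_mul_self', one_div]
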